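/- arXiv:1701.01265 — 7 statements merged into one kernel-verified Lean document; each statement's English description precedes it below -/
import Mathlib

section
/- Let N ≥ 2 be an integer and let u, v, A, B, C, D : ZMod N → ℝ be periodic grid functions satisfying, for every j ∈ ZMod N, v_j = u_j − A_j (u_j − u_{j−1}) + B_j (u_{j+1} − u_j) − C_j (v_j − v_{j−1}) + D_j (v_{j+1} − v_j). If A_j ≥ 0, B_j ≥ 0, C_j ≥ 0, D_j ≥ 0 for all j, and A_{j+1} + B_j ≤ 1 for all j, then the discrete total variation of v is bounded by that of u: ∑_{j ∈ ZMod N} |v_{j+1} − v_j| ≤ ∑_{j ∈ ZMod N} |u_{j+1} − u_j|. -/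
set_option autoImplicit false

/-- **Harten's lemma, extended version, part (i): TV bound.**
If the periodic grid function `v` is obtained from `u` via the update
`v j = u j - A j (u j - u (j-1)) + B j (u (j+1) - u j) - C j (v j - v (j-1)) + D j (v (j+1) - v j)`
with nonnegative coefficients satisfying `A (j+1) + B j ≤ 1`, then the discrete total
variation of `v` is bounded by that of `u`. -/
theorem harten_tv_bound (N : ℕ) [NeZero N] (hN : 2 ≤ N)
    (u v A B C D : ZMod N → ℝ)
    (hupd : ∀ j : ZMod N,
      v j = u j - A j * (u j - u (j - 1)) + B j * (u (j + 1) - u j)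
            - C j * (v j - v (j - 1)) + D j * (v (j + 1) - v j))
    (hA : ∀ j, 0 ≤ A j) (hB : ∀ j, 0 ≤ B j) (hC : ∀ j, 0 ≤ C j) (hD : ∀ j, 0 ≤ D j)
    (hAB : ∀ j : ZMod N, A (j + 1) + B j ≤ 1) :
    ∑ j : ZMod N, |v (j + 1) - v j| ≤ ∑ j : ZMod N, |u (j + 1) - u j| := by
  set p : ZMod N → ℝ := fun j => u (j + 1) - u j with hp
  set q : ZMod N → ℝ := fun j => v (j + 1) - v j with hq
  have shift (f : ZMod N → ℝ) : ∑ j, f (j + 1) = ∑ j, f j :=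
    Equiv.sum_comp (Equiv.addRight 1) f
  have pointwise (j : ZMod N) :
      |q j| + C (j + 1) * |q j| + D j * |q j| ≤
        (|p j| - A (j + 1) * |p j| - B j * |p j|) + A j * |p (j - 1)|
          + B (j + 1) * |p (j + 1)| + C j * |q (j - 1)| + D (j + 1) * |q (j + 1)| := by
    have key : (1 + C (j + 1) + D j) * q j =
        (1 - A (j + 1) - B j) * p j + A j * p (j - 1) + B (j + 1) * p (j + 1)
          + C j * q (j - 1) + D (j + 1) * q (j + 1) := by
      have h₀ := hupd j
      have h₁ := hupd (j + 1)
      simp only [hp, hq, sub_add_cancel, add_sub_cancel_right] at h₀ h₁ ⊢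
      linear_combination h₁ - h₀
    have hpos : 0 ≤ 1 + C (j + 1) + D j := by linarith [hC (j + 1), hD j]
    have hrem : 0 ≤ 1 - A (j + 1) - B j := by linarith [hAB j]
    calc
      _ = |(1 + C (j + 1) + D j) * q j| := by
        rw [abs_mul, abs_of_nonneg hpos]; ring
      _ ≤ |(1 - A (j + 1) - B j) * p j| + |A j * p (j - 1)| + |B (j + 1) * p (j + 1)|
          + |C j * q (j - 1)| + |D (j + 1) * q (j + 1)| := by
        rw [key]
        refine (abs_add_le _ _).trans (add_le_add_left ?_ _)
        refine (abs_add_le _ _).trans (add_le_add_left ?_ _)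
        exact abs_add_three _ _ _
      _ = _ := by
        rw [abs_mul, abs_mul, abs_mul, abs_mul, abs_mul, abs_of_nonneg hrem,
          abs_of_nonneg (hA j), abs_of_nonneg (hB (j + 1)), abs_of_nonneg (hC j),
          abs_of_nonneg (hD (j + 1))]
        ring
  have total := Finset.sum_le_sum fun j (_ : j ∈ Finset.univ) => pointwise j
  simp only [Finset.sum_add_distrib, Finset.sum_sub_distrib] at total
  have shiftA := shift fun j => A j * |p (j - 1)|
  have shiftB := shift fun j => B j * |p j|
  have shiftC := shift fun j => C j * |q (j - 1)|
  have shiftD := shift fun j => D j * |q j|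
  simp only [add_sub_cancel_right] at shiftA shiftC
  change ∑ j, |q j| ≤ ∑ j, |p j|
  linarith
end

section
/- Let N ≥ 2 be an integer and let u, v, A, B, C, D : ZMod N → ℝ be periodic grid functions satisfying, for every j ∈ ZMod N, v_j = u_j − A_j (u_j − u_{j−1}) + B_j (u_{j+1} − u_j) − C_j (v_j − v_{j−1}) + D_j (v_{j+1} − v_j). If A_j ≥ 0, B_j ≥ 0, C_j ≥ 0, D_j ≥ 0 for all j, and A_j + B_j ≤ 1 for all j, then v satisfies the discrete maximum principle: for every j, min_{i ∈ ZMod N} u_i ≤ v_j ≤ max_{i ∈ ZMod N} u_i. -/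
set_option autoImplicit false

/-- Upper half of the maximum principle: an upper bound of `u` is an upper bound of `v`. -/
theorem harten_le_of_le {N : ℕ} [NeZero N] {u v A B C D : ZMod N → ℝ} {M : ℝ}
    (hupd : ∀ j : ZMod N,
      v j = u j - A j * (u j - u (j - 1)) + B j * (u (j + 1) - u j)
            - C j * (v j - v (j - 1)) + D j * (v (j + 1) - v j))
    (hA : ∀ j, 0 ≤ A j) (hB : ∀ j, 0 ≤ B j) (hC : ∀ j, 0 ≤ C j) (hD : ∀ j, 0 ≤ D j)
    (hAB : ∀ j : ZMod N, A j + B j ≤ 1) (hu : ∀ j, u j ≤ M) (j : ZMod N) : v j ≤ M := by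
  obtain ⟨k, hk⟩ := Finite.exists_max v
  refine (hk j).trans ?_
  have hCk : 0 ≤ C k * (v k - v (k - 1)) := mul_nonneg (hC k) (sub_nonneg.2 (hk _))
  have hDk : 0 ≤ D k * (v k - v (k + 1)) := mul_nonneg (hD k) (sub_nonneg.2 (hk _))
  have hAk : 0 ≤ A k * (M - u (k - 1)) := mul_nonneg (hA k) (sub_nonneg.2 (hu _))
  have hBk : 0 ≤ B k * (M - u (k + 1)) := mul_nonneg (hB k) (sub_nonneg.2 (hu _))
  have hABk : 0 ≤ (1 - (A k + B k)) * (M - u k) :=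
    mul_nonneg (sub_nonneg.2 (hAB k)) (sub_nonneg.2 (hu _))
  linarith [hupd k]

/-- **Harten's lemma, extended version, part (ii): discrete maximum principle.**
If the periodic grid function `v` is obtained from `u` via the update
`v j = u j - A j (u j - u (j-1)) + B j (u (j+1) - u j) - C j (v j - v (j-1)) + D j (v (j+1) - v j)`
with nonnegative coefficients satisfying `A j + B j ≤ 1`, then
`min_i u i ≤ v j ≤ max_i u i` for every `j`. -/
theorem harten_max_principle (N : ℕ) [NeZero N] (hN : 2 ≤ N)
    (u v A B C D : ZMod N → ℝ)
    (hupd : ∀ j : ZMod N,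
      v j = u j - A j * (u j - u (j - 1)) + B j * (u (j + 1) - u j)
            - C j * (v j - v (j - 1)) + D j * (v (j + 1) - v j))
    (hA : ∀ j, 0 ≤ A j) (hB : ∀ j, 0 ≤ B j) (hC : ∀ j, 0 ≤ C j) (hD : ∀ j, 0 ≤ D j)
    (hAB : ∀ j : ZMod N, A j + B j ≤ 1) :
    ∀ j : ZMod N,
      Finset.univ.inf' Finset.univ_nonempty u ≤ v j ∧
      v j ≤ Finset.univ.sup' Finset.univ_nonempty u := by
  intro j
  constructor
  · have h : -v j ≤ -Finset.univ.inf' Finset.univ_nonempty u :=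
      harten_le_of_le (u := fun i => -u i) (v := fun i => -v i)
        (fun i => by linarith [hupd i]) hA hB hC hD hAB
        (fun i => neg_le_neg (Finset.inf'_le u (Finset.mem_univ i))) j
    exact neg_le_neg_iff.1 h
  · exact harten_le_of_le hupd hA hB hC hD hAB
      (fun i => Finset.le_sup' u (Finset.mem_univ i)) j
end

section
/- Let (w^n_j) be a solution of the θ-scheme with 0 ≤ B(ξ) ≤ 1 for all ξ ∈ ℝ and with the CFL condition λ(1−θ) < 1/2, λ = Δt/(Δx)². Then for every n ∈ ℕ and j ∈ ZMod N: min_{i} w^0_i ≤ w^n_j ≤ max_{i} w^0_i, and the discrete total variation is nonincreasing: ∑_{j ∈ ZMod N} |w^n_{j+1} − w^n_j| ≤ ∑_{j ∈ ZMod N} |w^0_{j+1} − w^0_j|. -/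
set_option autoImplicit false

/-- Grid spacing `Δx = 1/N` on the periodic domain `[0,1]`. -/
noncomputable def gridDx (N : ℕ) : ℝ := 1 / N

/-- `(w n j)` is a solution of the θ-scheme `D_t^+ w^n_j = B(w^{n+θ}_j) D² w^{n+θ}_j`
for `w_t = B(w) w_xx` on a periodic grid of `N` cells, where
`w^{n+θ}_j = θ w^{n+1}_j + (1-θ) w^n_j` and
`D² a_j = (a_{j+1} - 2 a_j + a_{j-1})/(Δx)²`. -/
def IsThetaScheme (N : ℕ) (θ Δt : ℝ) (B : ℝ → ℝ) (w : ℕ → ZMod N → ℝ) : Prop :=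
  ∀ (n : ℕ) (j : ZMod N),
    (w (n + 1) j - w n j) / Δt =
      B (θ * w (n + 1) j + (1 - θ) * w n j) *
        (((θ * w (n + 1) (j + 1) + (1 - θ) * w n (j + 1))
          - 2 * (θ * w (n + 1) j + (1 - θ) * w n j)
          + (θ * w (n + 1) (j - 1) + (1 - θ) * w n (j - 1))) / (gridDx N) ^ 2)

/-- One step `u ↦ v` of the `θ`-scheme, with the local diffusion numbers `c j = λ B(w^{n+θ}_j)`. -/
def IsThetaStep {N : ℕ} (θ : ℝ) (c u v : ZMod N → ℝ) : Prop :=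
  ∀ j : ZMod N, v j - u j =
    c j * ((θ * v (j + 1) + (1 - θ) * u (j + 1)) - 2 * (θ * v j + (1 - θ) * u j)
      + (θ * v (j - 1) + (1 - θ) * u (j - 1)))

namespace IsThetaStep

variable {N : ℕ} {θ : ℝ} {c u v : ZMod N → ℝ}

theorem neg (h : IsThetaStep θ c u v) : IsThetaStep θ c (-u) (-v) := by
  intro j
  simp only [Pi.neg_apply]
  linear_combination -h j

theorem le_of_forall_le [NeZero N] (h : IsThetaStep θ c u v) (hθ0 : 0 ≤ θ) (hθ1 : θ ≤ 1)
    (hc0 : ∀ j, 0 ≤ c j) (hc1 : ∀ j, c j * (1 - θ) ≤ 1 / 2) {M : ℝ} (hu : ∀ j, u j ≤ M)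
    (j : ZMod N) : v j ≤ M := by
  obtain ⟨k, hk⟩ := Finite.exists_max v
  refine (hk j).trans ?_
  have h1 := mul_nonneg (mul_nonneg (hc0 k) hθ0) (sub_nonneg.2 (hk (k + 1)))
  have h2 := mul_nonneg (mul_nonneg (hc0 k) hθ0) (sub_nonneg.2 (hk (k - 1)))
  have h3 := mul_nonneg (mul_nonneg (hc0 k) (sub_nonneg.2 hθ1)) (sub_nonneg.2 (hu (k + 1)))
  have h4 := mul_nonneg (mul_nonneg (hc0 k) (sub_nonneg.2 hθ1)) (sub_nonneg.2 (hu (k - 1)))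
  have h5 := mul_nonneg (sub_nonneg.2 (hc1 k)) (sub_nonneg.2 (hu k))
  linear_combination h k + h1 + h2 + h3 + h4 + 2 * h5

theorem le_of_forall_ge [NeZero N] (h : IsThetaStep θ c u v) (hθ0 : 0 ≤ θ) (hθ1 : θ ≤ 1)
    (hc0 : ∀ j, 0 ≤ c j) (hc1 : ∀ j, c j * (1 - θ) ≤ 1 / 2) {m : ℝ} (hu : ∀ j, m ≤ u j)
    (j : ZMod N) : m ≤ v j :=
  neg_le_neg_iff.1 (h.neg.le_of_forall_le hθ0 hθ1 hc0 hc1 (fun i => neg_le_neg (hu i)) j)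

/-- The increments of a `θ`-step satisfy a scheme with nonnegative coefficients. -/
theorem abs_increment_le (h : IsThetaStep θ c u v) (hθ0 : 0 ≤ θ) (hθ1 : θ ≤ 1)
    (hc0 : ∀ j, 0 ≤ c j) (hc1 : ∀ j, c j * (1 - θ) ≤ 1 / 2) (j : ZMod N) :
    (1 + θ * (c (j + 1) + c j)) * |v (j + 1) - v j| ≤
      (1 - (1 - θ) * (c (j + 1) + c j)) * |u (j + 1) - u j|
        + θ * (c (j + 1) * |v (j + 1 + 1) - v (j + 1)| + c j * |v j - v (j - 1)|)
        + (1 - θ) * (c (j + 1) * |u (j + 1 + 1) - u (j + 1)| + c j * |u j - u (j - 1)|) := by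
  have hθ2 := sub_nonneg.2 hθ1
  have hp : 0 ≤ 1 + θ * (c (j + 1) + c j) := by
    have := mul_nonneg hθ0 (add_nonneg (hc0 (j + 1)) (hc0 j))
    linarith
  have hq : 0 ≤ 1 - (1 - θ) * (c (j + 1) + c j) := by
    linear_combination hc1 (j + 1) + hc1 j
  have key : (1 + θ * (c (j + 1) + c j)) * (v (j + 1) - v j) =
      (1 - (1 - θ) * (c (j + 1) + c j)) * (u (j + 1) - u j)
        + θ * (c (j + 1) * (v (j + 1 + 1) - v (j + 1)) + c j * (v j - v (j - 1)))
        + (1 - θ) * (c (j + 1) * (u (j + 1 + 1) - u (j + 1)) + c j * (u j - u (j - 1))) := by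
    have h1 := h (j + 1)
    rw [add_sub_cancel_right] at h1
    linear_combination h1 - h j
  have hbound : ∀ {a x : ℝ}, 0 ≤ a → a * x ≤ a * |x| ∧ -(a * x) ≤ a * |x| := fun {a x} ha =>
    ⟨mul_le_mul_of_nonneg_left (le_abs_self x) ha, by
      rw [← mul_neg]; exact mul_le_mul_of_nonneg_left (neg_le_abs x) ha⟩
  have b1 := hbound (x := u (j + 1) - u j) hq
  have b2 := hbound (x := v (j + 1 + 1) - v (j + 1)) (mul_nonneg hθ0 (hc0 (j + 1)))
  have b3 := hbound (x := v j - v (j - 1)) (mul_nonneg hθ0 (hc0 j))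
  have b4 := hbound (x := u (j + 1 + 1) - u (j + 1)) (mul_nonneg hθ2 (hc0 (j + 1)))
  have b5 := hbound (x := u j - u (j - 1)) (mul_nonneg hθ2 (hc0 j))
  nth_rewrite 1 [← abs_of_nonneg hp]
  rw [← abs_mul]
  refine abs_le'.2 ⟨?_, ?_⟩
  · linear_combination key + b1.1 + b2.1 + b3.1 + b4.1 + b5.1
  · linear_combination -key + b1.2 + b2.2 + b3.2 + b4.2 + b5.2

theorem sum_abs_increment_le [NeZero N] (h : IsThetaStep θ c u v) (hθ0 : 0 ≤ θ) (hθ1 : θ ≤ 1)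
    (hc0 : ∀ j, 0 ≤ c j) (hc1 : ∀ j, c j * (1 - θ) ≤ 1 / 2) :
    ∑ j, |v (j + 1) - v j| ≤ ∑ j, |u (j + 1) - u j| := by
  have shift : ∀ a : ZMod N → ℝ,
      ∑ j, (c (j + 1) * |a (j + 1 + 1) - a (j + 1)| + c j * |a j - a (j - 1)|) =
        ∑ j, (c (j + 1) + c j) * |a (j + 1) - a j| := by
    intro a
    have e1 := Equiv.sum_comp (Equiv.addRight (1 : ZMod N)) fun j => c j * |a (j + 1) - a j|
    have e2 := Equiv.sum_comp (Equiv.addRight (1 : ZMod N)) fun j => c j * |a j - a (j - 1)|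
    simp only [Equiv.coe_addRight, add_sub_cancel_right] at e1 e2
    simp only [add_mul, Finset.sum_add_distrib]
    linear_combination e1 - e2
  have hsum := Finset.sum_le_sum fun j (_ : j ∈ Finset.univ) =>
    h.abs_increment_le hθ0 hθ1 hc0 hc1 j
  simp only [Finset.sum_add_distrib, sub_mul, one_mul, add_mul (1 : ℝ), mul_assoc, Finset.sum_sub_distrib, ← Finset.mul_sum] at hsum
  have sv := shift v
  have su := shift u
  simp only [Finset.sum_add_distrib] at sv su
  linear_combination hsum + θ * sv + (1 - θ) * su

end IsThetaStep

theorem IsThetaScheme.isThetaStep {N : ℕ} {θ Δt : ℝ} {B : ℝ → ℝ} {w : ℕ → ZMod N → ℝ}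
    (hw : IsThetaScheme N θ Δt B w) (hΔt : Δt ≠ 0) (n : ℕ) :
    IsThetaStep θ (fun j => Δt / gridDx N ^ 2 * B (θ * w (n + 1) j + (1 - θ) * w n j))
      (w n) (w (n + 1)) := by
  intro j
  rw [(div_eq_iff hΔt).1 (hw n j)]
  ring

/-- **Discrete maximum principle and TV bound for `w`.**
Solutions of the θ-scheme with `0 ≤ B ≤ 1` under the CFL condition
`λ(1-θ) < 1/2`, `λ = Δt/(Δx)²`, stay between the min and max of the initial data,
and their discrete total variation is nonincreasing. -/
theorem scheme_w_bounds (N : ℕ) [NeZero N] (hN : 2 ≤ N)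
    (θ Δt : ℝ) (hθ0 : 0 ≤ θ) (hθ1 : θ ≤ 1) (hΔt : 0 < Δt)
    (B : ℝ → ℝ) (hB0 : ∀ ξ : ℝ, 0 ≤ B ξ) (hB1 : ∀ ξ : ℝ, B ξ ≤ 1)
    (hCFL : Δt / (gridDx N) ^ 2 * (1 - θ) < 1 / 2)
    (w : ℕ → ZMod N → ℝ) (hw : IsThetaScheme N θ Δt B w) :
    ∀ (n : ℕ) (j : ZMod N),
      (Finset.univ.inf' Finset.univ_nonempty (w 0) ≤ w n j ∧
       w n j ≤ Finset.univ.sup' Finset.univ_nonempty (w 0)) ∧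
      ∑ i : ZMod N, |w n (i + 1) - w n i| ≤ ∑ i : ZMod N, |w 0 (i + 1) - w 0 i| := by
  have hl : 0 ≤ Δt / gridDx N ^ 2 := by positivity
  have hstep := hw.isThetaStep hΔt.ne'
  have hc0 : ∀ n j, 0 ≤ Δt / gridDx N ^ 2 * B (θ * w (n + 1) j + (1 - θ) * w n j) :=
    fun n j => mul_nonneg hl (hB0 _)
  have hc1 : ∀ n j,
      Δt / gridDx N ^ 2 * B (θ * w (n + 1) j + (1 - θ) * w n j) * (1 - θ) ≤ 1 / 2 := fun n j =>
    (mul_le_mul_of_nonneg_right (mul_le_of_le_one_right hl (hB1 _)) (sub_nonneg.2 hθ1)).trans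
      hCFL.le
  intro n
  induction n with
  | zero =>
    exact fun j => ⟨⟨Finset.inf'_le _ (Finset.mem_univ j), Finset.le_sup' _ (Finset.mem_univ j)⟩,
      le_rfl⟩
  | succ n ih =>
    exact fun j =>
      ⟨⟨(hstep n).le_of_forall_ge hθ0 hθ1 (hc0 n) (hc1 n) (fun i => (ih i).1.1) j,
        (hstep n).le_of_forall_le hθ0 hθ1 (hc0 n) (hc1 n) (fun i => (ih i).1.2) j⟩,
        ((hstep n).sum_abs_increment_le hθ0 hθ1 (hc0 n) (hc1 n)).trans (ih j).2⟩
end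

section
/- Let (w^n_j) be a solution of the θ-scheme with 0 ≤ B(ξ) ≤ 1 for all ξ ∈ ℝ and with the CFL condition λ(1−θ) < 1/2, λ = Δt/(Δx)², and set z^n_j = D₊w^n_j = (w^n_{j+1} − w^n_j)/Δx. Then for every n ∈ ℕ and j ∈ ZMod N: min_{i} z^0_i ≤ z^n_j ≤ max_{i} z^0_i, and ∑_{j ∈ ZMod N} |z^n_{j+1} − z^n_j| ≤ ∑_{j ∈ ZMod N} |z^0_{j+1} − z^0_j|. -/
set_option autoImplicit false

/-- One step of the θ-scheme for `z_t = (c z_x)_x` obeys the discrete maximum principle. -/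
theorem theta_step_le (N : ℕ) [NeZero N] {θ M : ℝ} (hθ0 : 0 ≤ θ) (hθ1 : θ ≤ 1)
    {c a b : ZMod N → ℝ} (hc : ∀ j, 0 ≤ c j) (hcfl : ∀ j, c j * (1 - θ) ≤ 1 / 2)
    (hstep : ∀ j, b j - a j =
      c (j + 1) * ((θ * b (j + 1) + (1 - θ) * a (j + 1)) - (θ * b j + (1 - θ) * a j)) -
      c j * ((θ * b j + (1 - θ) * a j) - (θ * b (j - 1) + (1 - θ) * a (j - 1))))
    (ha : ∀ j, a j ≤ M) (j : ZMod N) : b j ≤ M := by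
  obtain ⟨k, hk⟩ := Finite.exists_max b
  refine (hk j).trans ?_
  have h₁ := mul_nonneg (mul_nonneg (hc (k + 1)) hθ0) (sub_nonneg.2 (hk (k + 1)))
  have h₂ := mul_nonneg (mul_nonneg (hc k) hθ0) (sub_nonneg.2 (hk (k - 1)))
  have h₃ := mul_nonneg (mul_nonneg (hc (k + 1)) (sub_nonneg.2 hθ1)) (sub_nonneg.2 (ha (k + 1)))
  have h₄ := mul_nonneg (mul_nonneg (hc k) (sub_nonneg.2 hθ1)) (sub_nonneg.2 (ha (k - 1)))
  have h₅ : 0 ≤ (1 - c (k + 1) * (1 - θ) - c k * (1 - θ)) * (M - a k) :=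
    mul_nonneg (by linarith [hcfl k, hcfl (k + 1)]) (sub_nonneg.2 (ha k))
  linarith [hstep k]

/-- One step of the θ-scheme for `d_t = (k d)_xx` is nonexpansive in `ℓ¹`. -/
theorem sum_abs_theta_step_le (N : ℕ) [NeZero N] {θ : ℝ} (hθ0 : 0 ≤ θ) (hθ1 : θ ≤ 1)
    {k d e : ZMod N → ℝ} (hk : ∀ j, 0 ≤ k j) (hcfl : ∀ j, k j * (1 - θ) ≤ 1 / 2)
    (hstep : ∀ j, e j - d j =
      k (j + 1) * (θ * e (j + 1) + (1 - θ) * d (j + 1)) -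
      2 * (k j * (θ * e j + (1 - θ) * d j)) +
      k (j - 1) * (θ * e (j - 1) + (1 - θ) * d (j - 1))) :
    ∑ j, |e j| ≤ ∑ j, |d j| := by
  set g : ZMod N → ℝ := fun j => k j * (θ * |e j| + (1 - θ) * |d j|) with hg
  have hbound : ∀ j, |k j * (θ * e j + (1 - θ) * d j)| ≤ g j := fun j => by
    rw [abs_mul, abs_of_nonneg (hk j)]
    refine mul_le_mul_of_nonneg_left ((abs_add_le _ _).trans_eq ?_) (hk j)
    rw [abs_mul, abs_mul, abs_of_nonneg hθ0, abs_of_nonneg (sub_nonneg.2 hθ1)]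
  have hpt : ∀ j, |e j| ≤ |d j| + g (j + 1) + g (j - 1) - 2 * g j := fun j => by
    have hp : 0 ≤ 1 + 2 * (k j * θ) := by linarith [mul_nonneg (hk j) hθ0]
    have hq : 0 ≤ 1 - 2 * (k j * (1 - θ)) := by linarith [hcfl j]
    have heq : (1 + 2 * (k j * θ)) * e j = (1 - 2 * (k j * (1 - θ))) * d j +
        k (j + 1) * (θ * e (j + 1) + (1 - θ) * d (j + 1)) +
        k (j - 1) * (θ * e (j - 1) + (1 - θ) * d (j - 1)) := by linarith [hstep j]
    have habs := congrArg abs heq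
    rw [abs_mul, abs_of_nonneg hp] at habs
    have htri := abs_add_three ((1 - 2 * (k j * (1 - θ))) * d j)
      (k (j + 1) * (θ * e (j + 1) + (1 - θ) * d (j + 1)))
      (k (j - 1) * (θ * e (j - 1) + (1 - θ) * d (j - 1)))
    rw [abs_mul (1 - 2 * (k j * (1 - θ))), abs_of_nonneg hq] at htri
    have hgj : g j = k j * (θ * |e j| + (1 - θ) * |d j|) := rfl
    linarith [hbound (j + 1), hbound (j - 1)]
  have hr : ∑ j, g (j + 1) = ∑ j, g j := Equiv.sum_comp (Equiv.addRight 1) g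
  have hl : ∑ j, g (j - 1) = ∑ j, g j := Equiv.sum_comp (Equiv.subRight 1) g
  have hsum := Finset.sum_le_sum fun j (_ : j ∈ Finset.univ) => hpt j
  rw [Finset.sum_sub_distrib, Finset.sum_add_distrib, Finset.sum_add_distrib,
    ← Finset.mul_sum, hr, hl] at hsum
  linarith

/-- **Discrete maximum principle and TV bound for `z = D₊w`.**
For solutions of the θ-scheme with `0 ≤ B ≤ 1` under the CFL condition
`λ(1-θ) < 1/2`, `λ = Δt/(Δx)²`, the discrete derivative
`z^n_j = (w^n_{j+1} - w^n_j)/Δx` stays between the min and max of `z⁰`, and its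
discrete total variation is nonincreasing. -/
theorem scheme_z_bounds (N : ℕ) [NeZero N] (hN : 2 ≤ N)
    (θ Δt : ℝ) (hθ0 : 0 ≤ θ) (hθ1 : θ ≤ 1) (hΔt : 0 < Δt)
    (B : ℝ → ℝ) (hB0 : ∀ ξ : ℝ, 0 ≤ B ξ) (hB1 : ∀ ξ : ℝ, B ξ ≤ 1)
    (hCFL : Δt / (gridDx N) ^ 2 * (1 - θ) < 1 / 2)
    (w : ℕ → ZMod N → ℝ) (hw : IsThetaScheme N θ Δt B w)
    (z : ℕ → ZMod N → ℝ)
    (hz : ∀ (n : ℕ) (j : ZMod N), z n j = (w n (j + 1) - w n j) / gridDx N) :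
    ∀ (n : ℕ) (j : ZMod N),
      (Finset.univ.inf' Finset.univ_nonempty (z 0) ≤ z n j ∧
       z n j ≤ Finset.univ.sup' Finset.univ_nonempty (z 0)) ∧
      ∑ i : ZMod N, |z n (i + 1) - z n i| ≤ ∑ i : ZMod N, |z 0 (i + 1) - z 0 i| := by
  have hdx : 0 < gridDx N := by
    unfold gridDx
    have : (0 : ℝ) < N := by exact_mod_cast (by omega : 0 < N)
    positivity
  have hlam : 0 ≤ Δt / (gridDx N) ^ 2 := by positivity
  set c : ℕ → ZMod N → ℝ := fun n j =>
    Δt / (gridDx N) ^ 2 * B (θ * w (n + 1) j + (1 - θ) * w n j) with hcdef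
  have hc : ∀ n j, 0 ≤ c n j := fun n j => mul_nonneg hlam (hB0 _)
  have hcfl : ∀ n j, c n j * (1 - θ) ≤ 1 / 2 := fun n j =>
    (mul_le_mul_of_nonneg_right (mul_le_of_le_one_right hlam (hB1 _))
      (sub_nonneg.2 hθ1)).trans hCFL.le
  have hwstep : ∀ n j, (w (n + 1) j - w n j) / gridDx N = c n j *
      ((θ * z (n + 1) j + (1 - θ) * z n j) -
        (θ * z (n + 1) (j - 1) + (1 - θ) * z n (j - 1))) := fun n j => by
    have h := hw n j
    rw [div_eq_iff hΔt.ne'] at h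
    rw [h]
    simp only [hcdef, hz, sub_add_cancel]
    field_simp
    ring
  have hstep : ∀ n j, z (n + 1) j - z n j =
      c n (j + 1) * ((θ * z (n + 1) (j + 1) + (1 - θ) * z n (j + 1)) -
        (θ * z (n + 1) j + (1 - θ) * z n j)) -
      c n j * ((θ * z (n + 1) j + (1 - θ) * z n j) -
        (θ * z (n + 1) (j - 1) + (1 - θ) * z n (j - 1))) := fun n j => by
    have h := hwstep n (j + 1)
    rw [add_sub_cancel_right] at h
    rw [← h, ← hwstep n j, hz, hz]
    ring
  have hupper : ∀ n j, z n j ≤ Finset.univ.sup' Finset.univ_nonempty (z 0) := fun n => by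
    induction n with
    | zero => exact fun j => Finset.le_sup' (z 0) (Finset.mem_univ j)
    | succ n ih => exact theta_step_le N hθ0 hθ1 (hc n) (hcfl n) (hstep n) ih
  have hlower : ∀ n j, Finset.univ.inf' Finset.univ_nonempty (z 0) ≤ z n j := fun n => by
    induction n with
    | zero => exact fun j => Finset.inf'_le (z 0) (Finset.mem_univ j)
    | succ n ih =>
      refine fun j => neg_le_neg_iff.1 (theta_step_le N (a := fun j => -z n j)
        (b := fun j => -z (n + 1) j) hθ0 hθ1 (hc n) (hcfl n) (fun i => ?_)
        (fun i => neg_le_neg (ih i)) j)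
      linarith [hstep n i]
  have htv : ∀ n, ∑ i : ZMod N, |z n (i + 1) - z n i| ≤ ∑ i : ZMod N, |z 0 (i + 1) - z 0 i| :=
    fun n => by
      induction n with
      | zero => exact le_rfl
      | succ n ih =>
        refine (sum_abs_theta_step_le N (k := fun j => c n (j + 1))
          (d := fun j => z n (j + 1) - z n j) (e := fun j => z (n + 1) (j + 1) - z (n + 1) j)
          hθ0 hθ1 (fun j => hc n _) (fun j => hcfl n _) (fun j => ?_)).trans ih
        have h := hstep n (j + 1)
        simp only [add_sub_cancel_right, sub_add_cancel] at h ⊢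
        linarith [hstep n j]
  exact fun n j => ⟨⟨hlower n j, hupper n j⟩, htv n⟩
end

section
/- Let N ≥ 2, Δx = 1/N, x_j = jΔx, and let a : ZMod N → ℝ be a periodic grid function, identified with a 1-periodic assignment of values a_j at the points x_j. Let L : [0,1] → ℝ be the continuous piecewise linear interpolant with L(x_j) = a_j and L linear on each [x_j, x_{j+1}], and let P : [0,1] → ℝ be the piecewise constant interpolant with P(x) = a_j for x ∈ [x_j − Δx/2, x_j + Δx/2) (interpreted periodically). Then ∫₀¹ |L(x) − P(x)| dx = (Δx/4) ∑_{j ∈ ZMod N} |a_{j+1} − a_j|. -/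
set_option autoImplicit false

theorem ZMod.sum_eq_sum_range {M : Type*} [AddCommMonoid M] (N : ℕ) [NeZero N] (f : ZMod N → M) :
    ∑ j : ZMod N, f j = ∑ k ∈ Finset.range N, f (k : ZMod N) := by
  refine Finset.sum_nbij' ZMod.val (fun k => (k : ZMod N)) ?_ ?_ ?_ ?_ ?_
  · exact fun j _ => Finset.mem_range.mpr (ZMod.val_lt j)
  · exact fun k _ => Finset.mem_univ _
  · exact fun j _ => ZMod.natCast_zmod_val j
  · exact fun k hk => ZMod.val_cast_of_lt (Finset.mem_range.mp hk)
  · exact fun j _ => by rw [ZMod.natCast_zmod_val]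

theorem intervalIntegrable_and_integral_eq_of_eqOn_Ioo {f g : ℝ → ℝ} {p q : ℝ} (hpq : p ≤ q)
    (hg : Continuous g) (h : Set.EqOn f g (Set.Ioo p q)) :
    IntervalIntegrable f MeasureTheory.volume p q ∧ ∫ x in p..q, f x = ∫ x in p..q, g x := by
  constructor
  · refine (hg.intervalIntegrable p q).congr_uIoo ?_
    rw [Set.uIoo_of_le hpq]
    exact h.symm
  · exact intervalIntegral.integral_congr_Ioo_of_le hpq h

theorem integral_mul_sub_left_endpoint (c p h : ℝ) :
    ∫ x in p..p + h, c * (x - p) = c * h ^ 2 / 2 := by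
  rw [intervalIntegral.integral_const_mul,
    intervalIntegral.integral_comp_sub_right (fun x => x) p]
  simp
  ring

theorem integral_mul_sub_right_endpoint (c q h : ℝ) :
    ∫ x in q - h..q, c * (q - x) = c * h ^ 2 / 2 := by
  rw [intervalIntegral.integral_const_mul,
    intervalIntegral.integral_comp_sub_left (fun x => x) q]
  simp
  ring

/-- The integral of a symmetric tent function over its support `[p, p + 2 * h]`. -/
theorem intervalIntegrable_and_integral_eq_of_tent {f : ℝ → ℝ} {c p h : ℝ} (hh : 0 ≤ h)
    (hleft : ∀ x ∈ Set.Ioo p (p + h), f x = c * (x - p))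
    (hright : ∀ x ∈ Set.Ioo (p + h) (p + 2 * h), f x = c * (p + 2 * h - x)) :
    IntervalIntegrable f MeasureTheory.volume p (p + 2 * h) ∧
      ∫ x in p..p + 2 * h, f x = c * h ^ 2 := by
  obtain ⟨i₁, e₁⟩ := intervalIntegrable_and_integral_eq_of_eqOn_Ioo
    (by linarith : p ≤ p + h) (by fun_prop) hleft
  obtain ⟨i₂, e₂⟩ := intervalIntegrable_and_integral_eq_of_eqOn_Ioo
    (by linarith : p + h ≤ p + 2 * h) (by fun_prop) hright
  refine ⟨i₁.trans i₂, ?_⟩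
  have e₃ := integral_mul_sub_right_endpoint c (p + 2 * h) h
  rw [show p + 2 * h - h = p + h by ring] at e₃
  rw [← intervalIntegral.integral_add_adjacent_intervals i₁ i₂, e₁, e₂, e₃,
    integral_mul_sub_left_endpoint]
  ring

/-- **`L¹` distance between the piecewise linear and piecewise constant interpolations.**
Let `Δx = 1/N`, `x_j = j Δx`, and let `a : ZMod N → ℝ` be a periodic grid function.
If `L` is the (1-periodic) continuous piecewise linear interpolant with `L x_j = a j`,
linear on each `[x_j, x_{j+1}]`, and `P` is the (1-periodic) piecewise constant
interpolant with `P = a j` on `[x_j - Δx/2, x_j + Δx/2)`, then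
`∫₀¹ |L - P| = (Δx/4) ∑_j |a (j+1) - a j|`. -/
theorem pw_linear_pw_constant_L1_distance (N : ℕ) [NeZero N] (hN : 2 ≤ N)
    (a : ZMod N → ℝ) (L P : ℝ → ℝ)
    (hLcont : Continuous L)
    (hLper : ∀ x : ℝ, L (x + 1) = L x)
    (hPper : ∀ x : ℝ, P (x + 1) = P x)
    (hL : ∀ j : ZMod N, ∀ x ∈ Set.Ico ((j.val : ℝ) / N) (((j.val : ℝ) + 1) / N),
      L x = ((((j.val : ℝ) + 1) / N - x) * N) * a j
            + (((x - (j.val : ℝ) / N)) * N) * a (j + 1))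
    (hP : ∀ j : ZMod N,
      ∀ x ∈ Set.Ico ((j.val : ℝ) / N - 1 / (2 * N)) ((j.val : ℝ) / N + 1 / (2 * N)),
      P x = a j) :
    ∫ x in (0 : ℝ)..1, |L x - P x|
      = (1 / (4 * N)) * ∑ j : ZMod N, |a (j + 1) - a j| := by
  have hNpos : (0 : ℝ) < N := by exact_mod_cast (by omega : 0 < N)
  have hN0 : (N : ℝ) ≠ 0 := hNpos.ne'
  have hpos : 0 < 1 / (2 * (N : ℝ)) := by positivity
  have hnext (k : ℕ) : ((k + 1 : ℕ) : ℝ) / N = (k : ℝ) / N + 2 * (1 / (2 * N)) := by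
    push_cast
    field_simp
  have hcell (k : ℕ) (hk : k < N) :
      IntervalIntegrable (fun x => |L x - P x|) MeasureTheory.volume
          ((k : ℝ) / N) (((k + 1 : ℕ) : ℝ) / N) ∧
        ∫ x in ((k : ℝ) / N)..(((k + 1 : ℕ) : ℝ) / N), |L x - P x|
          = 1 / (4 * N) * |a ((k : ZMod N) + 1) - a k| := by
    have hval : ((k : ZMod N)).val = k := ZMod.val_cast_of_lt hk
    have hLk := hL k
    have hPk := hP k
    rw [hval] at hLk hPk
    have hPk' : ∀ x ∈ Set.Ioo ((k : ℝ) / N + 1 / (2 * N)) ((k : ℝ) / N + 2 * (1 / (2 * N))),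
        P x = a ((k : ZMod N) + 1) := by
      intro x hx
      rcases (by omega : k + 1 < N ∨ k + 1 = N) with hlt | heq
      · have hPs := hP ((k + 1 : ℕ) : ZMod N) x
        rw [ZMod.val_cast_of_lt hlt, hnext k, Nat.cast_succ] at hPs
        exact hPs ⟨by linarith [hx.1], by linarith [hx.2]⟩
      · have hzero : (k : ZMod N) + 1 = 0 := by
          rw [← Nat.cast_add_one, heq, ZMod.natCast_self]
        have hone : (k : ℝ) / N + 2 * (1 / (2 * N)) = 1 := by
          rw [← hnext, heq, div_self hN0]
        have hPs := hP 0 (x - 1)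
        rw [ZMod.val_zero, Nat.cast_zero, zero_div] at hPs
        rw [hzero, ← sub_add_cancel x 1, hPper]
        exact hPs ⟨by linarith [hx.1], by linarith [hx.2]⟩
    have hnext' : ((k : ℝ) + 1) / N = (k : ℝ) / N + 2 * (1 / (2 * N)) := by
      rw [← hnext, Nat.cast_succ]
    have hleft : ∀ x ∈ Set.Ioo ((k : ℝ) / N) ((k : ℝ) / N + 1 / (2 * N)),
        |L x - P x| = N * |a ((k : ZMod N) + 1) - a k| * (x - k / N) := by
      intro x hx
      have hx0 : 0 ≤ (N : ℝ) * (x - k / N) := mul_nonneg hNpos.le (by linarith [hx.1])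
      have key : L x - P x = N * (x - k / N) * (a ((k : ZMod N) + 1) - a k) := by
        rw [hLk x ⟨hx.1.le, by linarith [hx.2]⟩, hPk x ⟨by linarith [hx.1], hx.2⟩]
        field_simp
        ring
      simp only [key, abs_mul (_ * _), abs_of_nonneg hx0]
      ring
    have hright : ∀ x ∈ Set.Ioo ((k : ℝ) / N + 1 / (2 * N)) ((k : ℝ) / N + 2 * (1 / (2 * N))),
        |L x - P x| = N * |a ((k : ZMod N) + 1) - a k| * (k / N + 2 * (1 / (2 * N)) - x) := by
      intro x hx
      have hx0 : 0 ≤ (N : ℝ) * ((k + 1) / N - x) :=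
        mul_nonneg hNpos.le (by linarith [hx.2])
      have key : L x - P x = -(N * ((k + 1) / N - x) * (a ((k : ZMod N) + 1) - a k)) := by
        rw [hLk x ⟨by linarith [hx.1], by linarith [hx.2]⟩, hPk' x hx]
        field_simp
        ring
      simp only [key, abs_neg, abs_mul (_ * _), abs_of_nonneg hx0, ← hnext']
      ring
    rw [hnext]
    obtain ⟨hi, he⟩ := intervalIntegrable_and_integral_eq_of_tent hpos.le hleft hright
    refine ⟨hi, he.trans ?_⟩
    field_simp
    norm_num
  have hsum := intervalIntegral.sum_integral_adjacent_intervals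
    (a := fun k : ℕ => (k : ℝ) / N) (fun k hk => (hcell k hk).1)
  simp only [Nat.cast_zero, zero_div, div_self hN0] at hsum
  rw [← hsum, ZMod.sum_eq_sum_range, Finset.mul_sum]
  exact Finset.sum_congr rfl fun k hk => (hcell k (Finset.mem_range.mp hk)).2
end

section
/- Let (w^n_j) be a solution of the θ-scheme with 0 ≤ B(ξ) ≤ 1 for all ξ ∈ ℝ and with the CFL condition λ(1−θ) < 1/2, λ = Δt/(Δx)², and set z^n_j = (w^n_{j+1} − w^n_j)/Δx. Then for all natural numbers m ≤ n, Δx · ∑_{j ∈ ZMod N} |w^n_j − w^m_j| ≤ (n − m) Δt · ∑_{j ∈ ZMod N} |z^0_{j+1} − z^0_j|. -/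
set_option autoImplicit false

/-- The undivided second difference of a periodic grid function. -/
def secondDiff {N : ℕ} (a : ZMod N → ℝ) (j : ZMod N) : ℝ :=
  a (j + 1) - 2 * a j + a (j - 1)

theorem sum_comp_add_one {N : ℕ} [NeZero N] (f : ZMod N → ℝ) :
    ∑ j : ZMod N, f (j + 1) = ∑ j : ZMod N, f j :=
  Equiv.sum_comp (Equiv.addRight (1 : ZMod N)) f

theorem sum_comp_sub_one {N : ℕ} [NeZero N] (f : ZMod N → ℝ) :
    ∑ j : ZMod N, f (j - 1) = ∑ j : ZMod N, f j :=
  Equiv.sum_comp (Equiv.subRight (1 : ZMod N)) f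

/-- The θ-scheme for `u_t = (b u)_xx` is an `ℓ¹` contraction under the CFL condition. -/
theorem sum_abs_le_of_conservative_theta_step {N : ℕ} [NeZero N] {l θ : ℝ} {b u v : ZMod N → ℝ}
    (hl : 0 ≤ l) (hθ0 : 0 ≤ θ) (hθ1 : θ ≤ 1) (hb0 : ∀ j, 0 ≤ b j) (hb1 : ∀ j, b j ≤ 1)
    (hCFL : l * (1 - θ) ≤ 1 / 2)
    (h : ∀ j, v j - u j = l * secondDiff (fun i => b i * (θ * v i + (1 - θ) * u i)) j) :
    ∑ j, |v j| ≤ ∑ j, |u j| := by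
  set P : ZMod N → ℝ := fun j => l * θ * b j * |v j| with hP
  set Q : ZMod N → ℝ := fun j => l * (1 - θ) * b j * |u j| with hQ
  have hp : ∀ j, 0 ≤ l * θ * b j := fun j => mul_nonneg (mul_nonneg hl hθ0) (hb0 j)
  have hq : ∀ j, 0 ≤ l * (1 - θ) * b j := fun j =>
    mul_nonneg (mul_nonneg hl (sub_nonneg.2 hθ1)) (hb0 j)
  have hP' : ∀ j, |l * θ * b j * v j| = P j := fun j => by rw [abs_mul, abs_of_nonneg (hp j)]
  have hQ' : ∀ j, |l * (1 - θ) * b j * u j| = Q j := fun j => by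
    rw [abs_mul, abs_of_nonneg (hq j)]
  have key : ∀ j, |v j| + 2 * P j
      ≤ |u j| - 2 * Q j + P (j + 1) + P (j - 1) + Q (j + 1) + Q (j - 1) := by
    intro j
    have hc : 0 ≤ 1 - 2 * (l * (1 - θ) * b j) := by
      have := mul_le_mul_of_nonneg_left (hb1 j) (mul_nonneg hl (sub_nonneg.2 hθ1))
      linarith
    have e1 : |v j| + 2 * P j = |(1 + 2 * (l * θ * b j)) * v j| := by
      rw [abs_mul, abs_of_nonneg (by linarith [hp j] : 0 ≤ 1 + 2 * (l * θ * b j))]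
      simp only [hP]
      ring
    have e2 : |u j| - 2 * Q j = |(1 - 2 * (l * (1 - θ) * b j)) * u j| := by
      rw [abs_mul, abs_of_nonneg hc]
      simp only [hQ]
      ring
    have e3 : (1 + 2 * (l * θ * b j)) * v j = (1 - 2 * (l * (1 - θ) * b j)) * u j
        + l * θ * b (j + 1) * v (j + 1) + l * θ * b (j - 1) * v (j - 1)
        + l * (1 - θ) * b (j + 1) * u (j + 1) + l * (1 - θ) * b (j - 1) * u (j - 1) := by
      have := h j
      simp only [secondDiff] at this
      linear_combination this
    rw [e1, e2, e3, ← hP', ← hP', ← hQ', ← hQ']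
    refine (abs_add_le _ _).trans (add_le_add_left ?_ _)
    refine (abs_add_le _ _).trans (add_le_add_left ?_ _)
    refine (abs_add_le _ _).trans (add_le_add_left ?_ _)
    exact abs_add_le _ _
  have hsum := Finset.sum_le_sum fun j (_ : j ∈ Finset.univ) => key j
  simp only [Finset.sum_add_distrib, Finset.sum_sub_distrib, ← Finset.mul_sum,
    sum_comp_add_one, sum_comp_sub_one] at hsum
  linarith

section ThetaScheme

variable {N : ℕ} {θ Δt : ℝ} {B : ℝ → ℝ} {w : ℕ → ZMod N → ℝ}

theorem IsThetaScheme.sub_eq (hw : IsThetaScheme N θ Δt B w) (hΔt : Δt ≠ 0) (n : ℕ)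
    (j : ZMod N) :
    w (n + 1) j - w n j = Δt / gridDx N ^ 2 * (B (θ * w (n + 1) j + (1 - θ) * w n j) *
      (θ * secondDiff (w (n + 1)) j + (1 - θ) * secondDiff (w n) j)) := by
  have h := hw n j
  rw [div_eq_iff hΔt] at h
  rw [h]
  simp only [secondDiff]
  ring

variable [NeZero N]

theorem IsThetaScheme.sum_abs_secondDiff_le (hw : IsThetaScheme N θ Δt B w)
    (hθ0 : 0 ≤ θ) (hθ1 : θ ≤ 1) (hΔt : 0 < Δt)
    (hB0 : ∀ ξ : ℝ, 0 ≤ B ξ) (hB1 : ∀ ξ : ℝ, B ξ ≤ 1)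
    (hCFL : Δt / gridDx N ^ 2 * (1 - θ) ≤ 1 / 2) (n : ℕ) :
    ∑ j, |secondDiff (w n) j| ≤ ∑ j, |secondDiff (w 0) j| := by
  induction n with
  | zero => exact le_rfl
  | succ n ih =>
    refine le_trans ?_ ih
    refine sum_abs_le_of_conservative_theta_step
      (b := fun j => B (θ * w (n + 1) j + (1 - θ) * w n j))
      (by positivity) hθ0 hθ1 (fun _ => hB0 _) (fun _ => hB1 _) hCFL fun j => ?_
    have h0 := hw.sub_eq hΔt.ne' n j
    have h1 := hw.sub_eq hΔt.ne' n (j + 1)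
    have h2 := hw.sub_eq hΔt.ne' n (j - 1)
    rw [secondDiff.eq_1 (fun i => B (θ * w (n + 1) i + (1 - θ) * w n i) * _)]
    have h3 : secondDiff (w (n + 1)) j - secondDiff (w n) j
        = (w (n + 1) (j + 1) - w n (j + 1)) - 2 * (w (n + 1) j - w n j)
          + (w (n + 1) (j - 1) - w n (j - 1)) := by
      simp only [secondDiff]; ring
    rw [h3, h0, h1, h2]
    ring

theorem IsThetaScheme.sum_abs_step_le (hw : IsThetaScheme N θ Δt B w)
    (hθ0 : 0 ≤ θ) (hθ1 : θ ≤ 1) (hΔt : 0 < Δt)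
    (hB0 : ∀ ξ : ℝ, 0 ≤ B ξ) (hB1 : ∀ ξ : ℝ, B ξ ≤ 1)
    (hCFL : Δt / gridDx N ^ 2 * (1 - θ) ≤ 1 / 2) (n : ℕ) :
    ∑ j, |w (n + 1) j - w n j| ≤ Δt / gridDx N ^ 2 * ∑ j, |secondDiff (w 0) j| := by
  have hl : 0 ≤ Δt / gridDx N ^ 2 := by positivity
  have hθ' : 0 ≤ 1 - θ := sub_nonneg.2 hθ1
  have hpt : ∀ j, |w (n + 1) j - w n j| ≤ Δt / gridDx N ^ 2 *
      (θ * |secondDiff (w (n + 1)) j| + (1 - θ) * |secondDiff (w n) j|) := by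
    intro j
    rw [hw.sub_eq hΔt.ne' n j, abs_mul, abs_of_nonneg hl, abs_mul, abs_of_nonneg (hB0 _)]
    refine mul_le_mul_of_nonneg_left ?_ hl
    refine (mul_le_of_le_one_left (abs_nonneg _) (hB1 _)).trans ((abs_add_le _ _).trans ?_)
    rw [abs_mul, abs_mul, abs_of_nonneg hθ0, abs_of_nonneg hθ']
  refine (Finset.sum_le_sum fun j _ => hpt j).trans ?_
  rw [← Finset.mul_sum, Finset.sum_add_distrib, ← Finset.mul_sum, ← Finset.mul_sum]
  refine mul_le_mul_of_nonneg_left ?_ hl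
  have h1 := mul_le_mul_of_nonneg_left
    (hw.sum_abs_secondDiff_le hθ0 hθ1 hΔt hB0 hB1 hCFL (n + 1)) hθ0
  have h2 := mul_le_mul_of_nonneg_left
    (hw.sum_abs_secondDiff_le hθ0 hθ1 hΔt hB0 hB1 hCFL n) hθ'
  linarith

end ThetaScheme

/-- **Discrete `L¹` time continuity estimate.**
For solutions of the θ-scheme with `0 ≤ B ≤ 1` under the CFL condition
`λ(1-θ) < 1/2`, `λ = Δt/(Δx)²`, with `z⁰_j = (w⁰_{j+1} - w⁰_j)/Δx`, one has for `m ≤ n`: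
`Δx ∑_j |w^n_j - w^m_j| ≤ (n-m) Δt ∑_j |z⁰_{j+1} - z⁰_j|`. -/
theorem scheme_time_continuity (N : ℕ) [NeZero N] (hN : 2 ≤ N)
    (θ Δt : ℝ) (hθ0 : 0 ≤ θ) (hθ1 : θ ≤ 1) (hΔt : 0 < Δt)
    (B : ℝ → ℝ) (hB0 : ∀ ξ : ℝ, 0 ≤ B ξ) (hB1 : ∀ ξ : ℝ, B ξ ≤ 1)
    (hCFL : Δt / (gridDx N) ^ 2 * (1 - θ) < 1 / 2)
    (w : ℕ → ZMod N → ℝ) (hw : IsThetaScheme N θ Δt B w)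
    (z : ZMod N → ℝ)
    (hz : ∀ j : ZMod N, z j = (w 0 (j + 1) - w 0 j) / gridDx N)
    (m n : ℕ) (hmn : m ≤ n) :
    gridDx N * ∑ j : ZMod N, |w n j - w m j|
      ≤ ((n : ℝ) - (m : ℝ)) * Δt * ∑ j : ZMod N, |z (j + 1) - z j| := by
  have hdx : 0 < gridDx N := by
    have : (0 : ℝ) < N := by exact_mod_cast (by omega : 0 < N)
    unfold gridDx
    positivity
  have hz' : ∑ j : ZMod N, |z (j + 1) - z j| = (∑ j, |secondDiff (w 0) j|) / gridDx N := by
    rw [← sum_comp_add_one fun j => |secondDiff (w 0) j|, Finset.sum_div]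
    refine Finset.sum_congr rfl fun j _ => ?_
    rw [hz, hz, ← sub_div, abs_div, abs_of_pos hdx]
    simp only [secondDiff, add_sub_cancel_right]
    ring_nf
  induction n, hmn using Nat.le_induction with
  | base => simp
  | succ n _ ih =>
    have hstep := mul_le_mul_of_nonneg_left
      (hw.sum_abs_step_le hθ0 hθ1 hΔt hB0 hB1 hCFL.le n) hdx.le
    have htri : ∑ j, |w (n + 1) j - w m j|
        ≤ ∑ j, |w (n + 1) j - w n j| + ∑ j, |w n j - w m j| := by
      rw [← Finset.sum_add_distrib]
      exact Finset.sum_le_sum fun j _ => abs_sub_le _ _ _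
    have htri' := mul_le_mul_of_nonneg_left htri hdx.le
    have heq : gridDx N * (Δt / gridDx N ^ 2 * ∑ j, |secondDiff (w 0) j|)
        = Δt * ∑ j : ZMod N, |z (j + 1) - z j| := by
      rw [hz']
      field_simp
    rw [heq] at hstep
    push_cast
    linarith
end

section
/- There exists a constant C > 0 with the following property. Let (w^n_j) be any solution of the θ-scheme with 0 ≤ B(ξ) ≤ 1 for all ξ ∈ ℝ and with the CFL condition λ(1−θ) < 1/2, λ = Δt/(Δx)². Set z^n_j = (w^n_{j+1} − w^n_j)/Δx and let z̄^{Δt}(x,t) = z^n_j for x ∈ [x_j, x_{j+1}), t ∈ [nΔt, (n+1)Δt). Then for all t ≥ 0 and τ > 0, ∫₀¹ |z̄^{Δt}(x, t+τ) − z̄^{Δt}(x, t)| dx ≤ C · max(∑_{j ∈ ZMod N} |z^0_{j+1} − z^0_j|, 1) · (√τ + Δt/√τ). -/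
set_option autoImplicit false

theorem ZMod.sum_comp_add_right {N : ℕ} [NeZero N] (f : ZMod N → ℝ) (a : ZMod N) :
    ∑ j, f (j + a) = ∑ j, f j :=
  Equiv.sum_comp (Equiv.addRight a) f

theorem ZMod.sum_comp_sub_right {N : ℕ} [NeZero N] (f : ZMod N → ℝ) (a : ZMod N) :
    ∑ j, f (j - a) = ∑ j, f j :=
  Equiv.sum_comp (Equiv.subRight a) f

/-- The discrete total variation of a periodic grid function. -/
def discreteTV {N : ℕ} [NeZero N] (a : ZMod N → ℝ) : ℝ := ∑ j, |a (j + 1) - a j|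

theorem discreteTV_nonneg {N : ℕ} [NeZero N] (a : ZMod N → ℝ) : 0 ≤ discreteTV a :=
  Finset.sum_nonneg fun _ _ => abs_nonneg _

theorem discreteTV_sub_le {N : ℕ} [NeZero N] (a b : ZMod N → ℝ) :
    discreteTV (a - b) ≤ discreteTV a + discreteTV b := by
  unfold discreteTV
  rw [← Finset.sum_add_distrib]
  refine Finset.sum_le_sum fun j _ => ?_
  have h := abs_sub (a (j + 1) - a j) (b (j + 1) - b j)
  simp only [Pi.sub_apply]
  refine le_of_eq_of_le (congrArg _ ?_) h
  ring

theorem sum_abs_sub_shift_le {N : ℕ} [NeZero N] (u : ZMod N → ℝ) (i : ℕ) :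
    ∑ j, |u j - u (j + i)| ≤ i * discreteTV u := by
  induction i with
  | zero => simp
  | succ i ih =>
    have h : ∑ j, |u (j + i + 1) - u (j + i)| = discreteTV u :=
      ZMod.sum_comp_add_right (fun j => |u (j + 1) - u j|) i
    have h' : ∑ j, |u j - u (j + (i + 1 : ℕ))|
        ≤ ∑ j, (|u j - u (j + i)| + |u (j + i + 1) - u (j + i)|) := by
      refine Finset.sum_le_sum fun j _ => ?_
      rw [abs_sub_comm (u (j + i + 1))]
      push_cast
      rw [← add_assoc]
      exact abs_sub_le _ _ _
    rw [Finset.sum_add_distrib, h] at h'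
    push_cast at h' ⊢
    linarith

theorem sum_abs_smul_diff_sub_le {N : ℕ} [NeZero N] (f u : ZMod N → ℝ)
    (hu : ∀ j, u j = f (j + 1) - f j) (k : ℕ) :
    ∑ j, |k * u j - (f (j + k) - f j)| ≤ k * (k - 1) / 2 * discreteTV u := by
  induction k with
  | zero => simp
  | succ k ih =>
    have h : ∑ j, |((k + 1 : ℕ) : ℝ) * u j - (f (j + (k + 1 : ℕ)) - f j)|
        ≤ ∑ j, (|k * u j - (f (j + k) - f j)| + |u j - u (j + k)|) := by
      refine Finset.sum_le_sum fun j _ => ?_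
      have h := abs_add_le (k * u j - (f (j + k) - f j)) (u j - u (j + k))
      refine le_of_eq_of_le (congrArg _ ?_) h
      rw [hu (j + k)]
      push_cast
      rw [← add_assoc]
      ring
    rw [Finset.sum_add_distrib] at h
    have := sum_abs_sub_shift_le u k
    push_cast at *
    linarith

/-- Discrete Landau–Kolmogorov type inequality in `ℓ¹` for periodic grid functions. -/
theorem mul_sum_abs_diff_le {N : ℕ} [NeZero N] (f u : ZMod N → ℝ)
    (hu : ∀ j, u j = f (j + 1) - f j) (k : ℕ) :
    k * ∑ j, |u j| ≤ 2 * ∑ j, |f j| + k * (k - 1) / 2 * discreteTV u := by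
  have h : ∑ j, (k : ℝ) * |u j|
      ≤ ∑ j, (|k * u j - (f (j + k) - f j)| + (|f (j + k)| + |f j|)) := by
    refine Finset.sum_le_sum fun j _ => ?_
    have h1 := abs_add_le (k * u j - (f (j + k) - f j)) (f (j + k) - f j)
    have h2 := abs_sub (f (j + k)) (f j)
    rw [sub_add_cancel, abs_mul, Nat.abs_cast] at h1
    linarith
  rw [Finset.sum_add_distrib, Finset.sum_add_distrib,
    ZMod.sum_comp_add_right (fun j => |f j|), ← Finset.mul_sum] at h
  linarith [sum_abs_smul_diff_sub_le f u hu k]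

/-- Time continuity of a conservative evolution with bounded flux and bounded variation. -/
theorem sum_abs_sub_le_of_conservative {N : ℕ} [NeZero N] (z g : ℕ → ZMod N → ℝ) {K V : ℝ}
    (hK : 0 ≤ K) (hz : ∀ n j, z (n + 1) j - z n j = g n (j + 1) - g n j)
    (hg : ∀ n, ∑ j, |g n j| ≤ K * V) (hV : ∀ n, discreteTV (z n) ≤ V) (n M : ℕ) :
    ∑ j, |z (n + M) j - z n j| ≤ 3 * √(K * M) * V := by
  have hV0 : 0 ≤ V := (discreteTV_nonneg _).trans (hV 0)
  set F : ZMod N → ℝ := fun j => ∑ i ∈ Finset.range M, g (n + i) j with hF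
  have hu : ∀ j, z (n + M) j - z n j = F (j + 1) - F j := by
    intro j
    simp only [hF]
    rw [← Finset.sum_sub_distrib]
    refine (Finset.sum_range_sub (fun i => z (n + i) j) M).symm.trans ?_
    exact Finset.sum_congr rfl fun i _ => hz (n + i) j
  have hFs : ∑ j, |F j| ≤ M * (K * V) := by
    calc ∑ j, |F j| ≤ ∑ j, ∑ i ∈ Finset.range M, |g (n + i) j| :=
          Finset.sum_le_sum fun j _ => Finset.abs_sum_le_sum_abs _ _
      _ = ∑ i ∈ Finset.range M, ∑ j, |g (n + i) j| := Finset.sum_comm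
      _ ≤ ∑ _i ∈ Finset.range M, K * V := Finset.sum_le_sum fun i _ => hg _
      _ = M * (K * V) := by simp
  have hD : discreteTV (z (n + M) - z n) ≤ 2 * V := by
    linarith [discreteTV_sub_le (z (n + M)) (z n), hV (n + M), hV n]
  set r := √(K * M) with hr
  have hr2 : r ^ 2 = K * M := Real.sq_sqrt (by positivity)
  have hr0 : 0 ≤ r := Real.sqrt_nonneg _
  rcases hr0.eq_or_lt with h0 | hpos
  · have h1 := mul_sum_abs_diff_le F (z (n + M) - z n) hu 1
    simp only [Pi.sub_apply] at h1
    rw [← h0] at hr2 ⊢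
    have : ∑ j, |F j| ≤ 0 := by
      calc _ ≤ _ := hFs
        _ = (K * M) * V := by ring
        _ = 0 := by rw [← hr2]; ring
    push_cast at h1
    linarith
  · set k := ⌈r⌉₊
    have hk1 : r ≤ k := Nat.le_ceil r
    have hk2 : (k : ℝ) - 1 ≤ r := by linarith [Nat.ceil_lt_add_one hr0]
    have hkpos : (0 : ℝ) < k := hpos.trans_le hk1
    have h1 := mul_sum_abs_diff_le F (z (n + M) - z n) hu k
    simp only [Pi.sub_apply] at h1
    have hk3 : (0 : ℝ) ≤ k - 1 := by
      have : (1 : ℝ) ≤ k := by exact_mod_cast Nat.ceil_pos.2 hpos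
      linarith
    have h2 : (k : ℝ) * (k - 1) / 2 * discreteTV (z (n + M) - z n)
        ≤ k * r / 2 * (2 * V) := by
      have := discreteTV_nonneg (z (n + M) - z n)
      gcongr
    have h3 : r * r * V ≤ k * r * V := by gcongr
    have h4 : (M : ℝ) * (K * V) = r * r * V := by linear_combination -V * hr2
    refine le_of_mul_le_mul_left ?_ hkpos
    linarith

/-- `ℓ¹` contraction for the differences of a θ-scheme. -/
theorem sum_abs_le_of_theta_step {N : ℕ} [NeZero N] (x y b : ZMod N → ℝ) {p q : ℝ}
    (hp : 0 ≤ p) (hq : 0 ≤ q) (hq2 : q ≤ 1 / 2) (hb0 : ∀ j, 0 ≤ b j) (hb1 : ∀ j, b j ≤ 1)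
    (h : ∀ j, x j - y j = b (j + 1) * (p * x (j + 1) + q * y (j + 1))
      - 2 * (b j * (p * x j + q * y j)) + b (j - 1) * (p * x (j - 1) + q * y (j - 1))) :
    ∑ j, |x j| ≤ ∑ j, |y j| := by
  have key : ∀ j, |x j| ≤ |y j|
      + (b (j + 1) * (p * |x (j + 1)| + q * |y (j + 1)|) - 2 * (b j * (p * |x j| + q * |y j|))
      + b (j - 1) * (p * |x (j - 1)| + q * |y (j - 1)|)) := by
    intro j
    have hbj := hb0 j
    have hbp := hb0 (j + 1)
    have hbm := hb0 (j - 1)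
    have hc : 0 ≤ 1 - 2 * q * b j := by nlinarith [hb1 j]
    have e : (1 + 2 * p * b j) * x j = (1 - 2 * q * b j) * y j
        + (b (j + 1) * (p * x (j + 1) + q * y (j + 1))
          + b (j - 1) * (p * x (j - 1) + q * y (j - 1))) := by
      linear_combination h j
    have hl : |(1 + 2 * p * b j) * x j| = (1 + 2 * p * b j) * |x j| := by
      rw [abs_mul, abs_of_nonneg (by positivity)]
    have hy : |(1 - 2 * q * b j) * y j| = (1 - 2 * q * b j) * |y j| := by
      rw [abs_mul, abs_of_nonneg hc]
    have aux : ∀ i, |b i * (p * x i + q * y i)| ≤ b i * (p * |x i| + q * |y i|) := by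
      intro i
      rw [abs_mul, abs_of_nonneg (hb0 i)]
      refine mul_le_mul_of_nonneg_left ((abs_add_le _ _).trans_eq ?_) (hb0 i)
      rw [abs_mul, abs_mul, abs_of_nonneg hp, abs_of_nonneg hq]
    have h1 := abs_add_le ((1 - 2 * q * b j) * y j)
      (b (j + 1) * (p * x (j + 1) + q * y (j + 1)) + b (j - 1) * (p * x (j - 1) + q * y (j - 1)))
    have h2 := abs_add_le (b (j + 1) * (p * x (j + 1) + q * y (j + 1)))
      (b (j - 1) * (p * x (j - 1) + q * y (j - 1)))
    rw [← e, hl, hy] at h1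
    linarith [aux (j + 1), aux (j - 1)]
  have hs := Finset.sum_le_sum fun j (_ : j ∈ Finset.univ) => key j
  rw [Finset.sum_add_distrib, Finset.sum_add_distrib, Finset.sum_sub_distrib, ← Finset.mul_sum,
    ZMod.sum_comp_add_right (fun j => b j * (p * |x j| + q * |y j|)),
    ZMod.sum_comp_sub_right (fun j => b j * (p * |x j| + q * |y j|))] at hs
  linarith

/-- The flux `B(w^{n+θ}_j) D² w^{n+θ}_j`, scaled by `Δt/Δx` and written through the difference
quotients `z`, of a θ-scheme solution. -/
noncomputable def thetaFlux (N : ℕ) (θ Δt : ℝ) (B : ℝ → ℝ) (w z : ℕ → ZMod N → ℝ)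
    (n : ℕ) (j : ZMod N) : ℝ :=
  Δt / gridDx N ^ 2 * (B (θ * w (n + 1) j + (1 - θ) * w n j) *
    (θ * (z (n + 1) j - z (n + 1) (j - 1)) + (1 - θ) * (z n j - z n (j - 1))))

section ThetaScheme

variable {N : ℕ} [NeZero N] {θ Δt : ℝ} {B : ℝ → ℝ} {w z : ℕ → ZMod N → ℝ}

theorem gridDx_pos : 0 < gridDx N := by
  have := Nat.pos_of_ne_zero (NeZero.ne N)
  unfold gridDx
  positivity

theorem IsThetaScheme.diff_eq_thetaFlux (hw : IsThetaScheme N θ Δt B w) (hΔt : 0 < Δt)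
    (hz : ∀ n j, z n j = (w n (j + 1) - w n j) / gridDx N) (n : ℕ) (j : ZMod N) :
    z (n + 1) j - z n j = thetaFlux N θ Δt B w z n (j + 1) - thetaFlux N θ Δt B w z n j := by
  have hx : gridDx N ≠ 0 := gridDx_pos.ne'
  have step : ∀ i, w (n + 1) i - w n i = gridDx N * thetaFlux N θ Δt B w z n i := by
    intro i
    have h := hw n i
    rw [div_eq_iff hΔt.ne'] at h
    rw [h, thetaFlux, hz, hz, hz, hz, sub_add_cancel]
    field_simp
    ring
  rw [hz, hz]
  field_simp
  linear_combination step (j + 1) - step j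

theorem IsThetaScheme.discreteTV_le (hw : IsThetaScheme N θ Δt B w) (hθ0 : 0 ≤ θ) (hθ1 : θ ≤ 1)
    (hΔt : 0 < Δt) (hB0 : ∀ ξ, 0 ≤ B ξ) (hB1 : ∀ ξ, B ξ ≤ 1)
    (hcfl : Δt / gridDx N ^ 2 * (1 - θ) < 1 / 2)
    (hz : ∀ n j, z n j = (w n (j + 1) - w n j) / gridDx N) (n : ℕ) :
    discreteTV (z n) ≤ discreteTV (z 0) := by
  induction n with
  | zero => rfl
  | succ n ih =>
    refine le_trans ?_ ih
    have hl : 0 ≤ Δt / gridDx N ^ 2 := by positivity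
    refine sum_abs_le_of_theta_step _ _
      (fun j => B (θ * w (n + 1) (j + 1) + (1 - θ) * w n (j + 1)))
      (mul_nonneg hl hθ0) (mul_nonneg hl (sub_nonneg.2 hθ1)) hcfl.le
      (fun _ => hB0 _) (fun _ => hB1 _) fun j => ?_
    have h1 := hw.diff_eq_thetaFlux hΔt hz n (j + 1)
    have h2 := hw.diff_eq_thetaFlux hΔt hz n j
    simp only [thetaFlux, add_sub_cancel_right, sub_add_cancel] at h1 h2 ⊢
    linear_combination h1 - h2

theorem sum_abs_thetaFlux_le (hθ0 : 0 ≤ θ) (hθ1 : θ ≤ 1) (hΔt : 0 < Δt)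
    (hB0 : ∀ ξ, 0 ≤ B ξ) (hB1 : ∀ ξ, B ξ ≤ 1) {V : ℝ} (hV : ∀ n, discreteTV (z n) ≤ V) (n : ℕ) :
    ∑ j, |thetaFlux N θ Δt B w z n j| ≤ Δt / gridDx N ^ 2 * V := by
  have hl : 0 ≤ Δt / gridDx N ^ 2 := by positivity
  have hθ' : 0 ≤ 1 - θ := sub_nonneg.2 hθ1
  have tv : ∀ m, ∑ j, |z m j - z m (j - 1)| = discreteTV (z m) := by
    intro m
    rw [← ZMod.sum_comp_add_right _ 1]
    simp [discreteTV]
  calc ∑ j, |thetaFlux N θ Δt B w z n j|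
      ≤ ∑ j, Δt / gridDx N ^ 2 *
          (θ * |z (n + 1) j - z (n + 1) (j - 1)| + (1 - θ) * |z n j - z n (j - 1)|) := by
        refine Finset.sum_le_sum fun j _ => ?_
        rw [thetaFlux, abs_mul, abs_of_nonneg hl, abs_mul, abs_of_nonneg (hB0 _)]
        refine mul_le_mul_of_nonneg_left ?_ hl
        refine (mul_le_of_le_one_left (abs_nonneg _) (hB1 _)).trans ?_
        refine (abs_add_le _ _).trans_eq ?_
        rw [abs_mul, abs_mul, abs_of_nonneg hθ0, abs_of_nonneg hθ']
    _ = Δt / gridDx N ^ 2 * (θ * discreteTV (z (n + 1)) + (1 - θ) * discreteTV (z n)) := by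
        rw [← Finset.mul_sum, Finset.sum_add_distrib, ← Finset.mul_sum, ← Finset.mul_sum, tv, tv]
    _ ≤ Δt / gridDx N ^ 2 * (θ * V + (1 - θ) * V) := by
        gcongr <;> exact hV _
    _ = Δt / gridDx N ^ 2 * V := by ring

end ThetaScheme

theorem ZMod.sum_range_natCast {N : ℕ} [NeZero N] (h : ZMod N → ℝ) :
    ∑ i ∈ Finset.range N, h (i : ZMod N) = ∑ j, h j := by
  refine Finset.sum_nbij' (fun i => (i : ZMod N)) ZMod.val (by simp)
    (fun j _ => Finset.mem_range.2 (ZMod.val_lt j)) (fun i hi => ?_) (by simp) (by simp)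
  exact ZMod.val_cast_of_lt (Finset.mem_range.1 hi)

theorem integral_of_piecewise_const {N : ℕ} [NeZero N] (f : ℝ → ℝ) (c : ZMod N → ℝ)
    (hf : ∀ j : ZMod N, ∀ x ∈ Set.Ico ((j.val : ℝ) / N) (((j.val : ℝ) + 1) / N), f x = c j) :
    ∫ x in (0 : ℝ)..1, f x = gridDx N * ∑ j, c j := by
  have hN : (0 : ℝ) < N := by exact_mod_cast Nat.pos_of_ne_zero (NeZero.ne N)
  have hle : ∀ i : ℕ, (i : ℝ) / N ≤ ((i + 1 : ℕ) : ℝ) / N := by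
    intro i
    gcongr
    simp
  have hae : ∀ i < N, ∀ᵐ x, x ∈ Set.uIoc ((i : ℝ) / N) (((i + 1 : ℕ) : ℝ) / N) →
      f x = c (i : ZMod N) := by
    intro i hi
    filter_upwards [MeasureTheory.Measure.ae_ne MeasureTheory.volume (((i + 1 : ℕ) : ℝ) / N)]
      with x hx hmem
    rw [Set.uIoc_of_le (hle i)] at hmem
    refine hf i x ?_
    rw [ZMod.val_cast_of_lt hi]
    refine ⟨hmem.1.le, ?_⟩
    have := lt_of_le_of_ne hmem.2 hx
    push_cast at this
    exact this
  have hint : ∀ i < N, IntervalIntegrable f MeasureTheory.volume ((i : ℝ) / N)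
      (((i + 1 : ℕ) : ℝ) / N) := by
    intro i hi
    refine (intervalIntegrable_const (c := c (i : ZMod N))).congr_ae ?_
    rw [Filter.EventuallyEq, MeasureTheory.ae_restrict_iff' measurableSet_uIoc]
    filter_upwards [hae i hi] with x hx hm using (hx hm).symm
  have hsum := intervalIntegral.sum_integral_adjacent_intervals
    (a := fun i : ℕ => (i : ℝ) / N) (n := N) (f := f) hint
  simp only [Nat.cast_zero, zero_div, div_self hN.ne'] at hsum
  rw [← hsum, ← ZMod.sum_range_natCast, Finset.mul_sum]
  refine Finset.sum_congr rfl fun i hi => ?_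
  rw [intervalIntegral.integral_congr_ae (hae i (Finset.mem_range.1 hi)),
    intervalIntegral.integral_const, smul_eq_mul, gridDx]
  congr 1
  push_cast
  ring

theorem mem_Ico_floor_mul {t Δt : ℝ} (ht : 0 ≤ t) (hΔt : 0 < Δt) :
    t ∈ Set.Ico ((⌊t / Δt⌋₊ : ℝ) * Δt) (((⌊t / Δt⌋₊ : ℝ) + 1) * Δt) :=
  ⟨(le_div_iff₀ hΔt).1 (Nat.floor_le (by positivity)),
    (div_lt_iff₀ hΔt).1 (Nat.lt_floor_add_one _)⟩

/-- **`L¹` time continuity of `z̄^{Δt}` (via Kružkov's interpolation lemma).**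
There is a universal constant `C > 0` such that for every θ-scheme solution
(under the CFL condition, `0 ≤ B ≤ 1`) the piecewise constant interpolation `Z` of
`z^n_j = (w^n_{j+1} - w^n_j)/Δx` satisfies, for all `t ≥ 0`, `τ > 0`,
`∫₀¹ |Z(x,t+τ) - Z(x,t)| dx ≤ C max(∑_j |z⁰_{j+1} - z⁰_j|, 1)(√τ + Δt/√τ)`. -/
theorem z_L1_time_continuity :
    ∃ C : ℝ, 0 < C ∧
      ∀ (N : ℕ) [NeZero N], 2 ≤ N →
      ∀ (θ Δt : ℝ), 0 ≤ θ → θ ≤ 1 → 0 < Δt →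
      ∀ B : ℝ → ℝ, (∀ ξ : ℝ, 0 ≤ B ξ) → (∀ ξ : ℝ, B ξ ≤ 1) →
      Δt / (gridDx N) ^ 2 * (1 - θ) < 1 / 2 →
      ∀ w : ℕ → ZMod N → ℝ, IsThetaScheme N θ Δt B w →
      ∀ z : ℕ → ZMod N → ℝ,
        (∀ (n : ℕ) (j : ZMod N), z n j = (w n (j + 1) - w n j) / gridDx N) →
      ∀ Z : ℝ → ℝ → ℝ,
        (∀ (n : ℕ) (j : ZMod N),
          ∀ x ∈ Set.Ico ((j.val : ℝ) / N) (((j.val : ℝ) + 1) / N),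
          ∀ t ∈ Set.Ico ((n : ℝ) * Δt) (((n : ℝ) + 1) * Δt),
          Z x t = z n j) →
      ∀ t τ : ℝ, 0 ≤ t → 0 < τ →
        ∫ x in (0 : ℝ)..1, |Z x (t + τ) - Z x t|
          ≤ C * max (∑ j : ZMod N, |z 0 (j + 1) - z 0 j|) 1
              * (Real.sqrt τ + Δt / Real.sqrt τ) := by
  refine ⟨3, by norm_num, ?_⟩
  intro N _ _ θ Δt hθ0 hθ1 hΔt B hB0 hB1 hcfl w hw z hz Z hZ t τ ht hτ
  have hV := hw.discreteTV_le hθ0 hθ1 hΔt hB0 hB1 hcfl hz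
  have hmain := sum_abs_sub_le_of_conservative z (thetaFlux N θ Δt B w z)
    (by positivity : 0 ≤ Δt / gridDx N ^ 2) (hw.diff_eq_thetaFlux hΔt hz)
    (sum_abs_thetaFlux_le hθ0 hθ1 hΔt hB0 hB1 hV) hV
  have hn := mem_Ico_floor_mul ht hΔt
  have hm := mem_Ico_floor_mul (add_nonneg ht hτ.le) hΔt
  set n := ⌊t / Δt⌋₊
  obtain ⟨M, hM⟩ : ∃ M, ⌊(t + τ) / Δt⌋₊ = n + M :=
    Nat.exists_eq_add_of_le (Nat.floor_mono (by gcongr; linarith))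
  rw [hM] at hm
  rw [integral_of_piecewise_const _ (fun j => |z (n + M) j - z n j|)
    fun j x hx => by rw [hZ _ j x hx _ hn, hZ _ j x hx _ hm]]
  have hx : 0 < gridDx N := gridDx_pos
  have hMt : (M : ℝ) * Δt ≤ τ + Δt := by
    have h1 := hm.1
    have h2 := hn.2
    push_cast at h1
    linarith
  have hsq : gridDx N * √(Δt / gridDx N ^ 2 * M) = √(M * Δt) := by
    rw [← Real.sqrt_sq hx.le, ← Real.sqrt_mul (sq_nonneg _), Real.sqrt_sq hx.le]
    congr 1
    field_simp
  have hτ' : √(M * Δt) ≤ √τ + Δt / √τ := by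
    have hs : 0 < √τ := Real.sqrt_pos.2 hτ
    refine (Real.sqrt_le_sqrt hMt).trans (Real.sqrt_le_iff.2 ⟨by positivity, ?_⟩)
    have e : (√τ + Δt / √τ) ^ 2 = τ + 2 * Δt + (Δt / √τ) ^ 2 := by
      field_simp
      rw [Real.sq_sqrt hτ.le]
      ring
    rw [e]
    linarith [sq_nonneg (Δt / √τ)]
  calc gridDx N * ∑ j, |z (n + M) j - z n j|
      ≤ gridDx N * (3 * √(Δt / gridDx N ^ 2 * M) * discreteTV (z 0)) := by
        gcongr
        exact hmain n M
    _ = 3 * discreteTV (z 0) * √(M * Δt) := by rw [← hsq]; ring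
    _ ≤ 3 * max (∑ j : ZMod N, |z 0 (j + 1) - z 0 j|) 1 * (√τ + Δt / √τ) := by
        gcongr
        exact le_max_left _ _
end
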